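/- arXiv:2001.10704 — 5 statements merged into one kernel-verified Lean document; each statement's English description precedes it below -/
import Mathlib

section
/- Let a, b, c, d be positive integers. Then the following are equivalent: (1) there exists a finite connected simple graph G with ind-match(G) = a, min-match(G) = b, match(G) = c and dim(G) = d; (2) 1 ≤ a ≤ b ≤ c ≤ 2b and d ≥ max{a, 2(c − b)}. -/
/-!
Formalization of results from "Matching numbers and dimension of edge ideals"
by A. Hirano and K. Matsuda.

For a finite simple graph `G`:
* a matching is a set of pairwise disjoint edges;
* a maximal matching is one that cannot be enlarged by any edge;
* an induced matching is a matching such that no edge of `G` meets two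
  distinct edges of the matching;
* `matchNum`, `minMatchNum`, `indMatchNum` are the corresponding maximum,
  minimum-maximal and maximum-induced sizes;
* `graphDim K G` is the Krull dimension of `K[V(G)]/I(G)`, where `I(G)` is
  the edge ideal of `G`.
-/

open MvPolynomial
open scoped Classical

noncomputable section

namespace EdgeIdealPaper

variable {V : Type*}

/-- `M` is a matching of `G`: a set of pairwise disjoint edges of `G`. -/
def IsMatching (G : SimpleGraph V) (M : Finset (Sym2 V)) : Prop :=
  (M : Set (Sym2 V)) ⊆ G.edgeSet ∧
    ∀ e ∈ M, ∀ f ∈ M, e ≠ f → ∀ v : V, v ∈ e → v ∉ f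

/-- `M` is a maximal matching of `G`: no edge of `G` outside `M` can be added. -/
def IsMaximalMatching (G : SimpleGraph V) (M : Finset (Sym2 V)) : Prop :=
  IsMatching G M ∧ ∀ e ∈ G.edgeSet, e ∉ M → ¬ IsMatching G (insert e M)

/-- `M` is an induced matching of `G`: a matching such that no edge of `G`
meets two distinct edges of `M`. -/
def IsInducedMatching (G : SimpleGraph V) (M : Finset (Sym2 V)) : Prop :=
  IsMatching G M ∧ ∀ e ∈ G.edgeSet, ∀ f ∈ M, ∀ g ∈ M, f ≠ g →
    ¬ ((∃ v : V, v ∈ e ∧ v ∈ f) ∧ (∃ v : V, v ∈ e ∧ v ∈ g))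

/-- The matching number `match(G)`: maximum size of a matching of `G`. -/
def matchNum (G : SimpleGraph V) : ℕ :=
  sSup {n | ∃ M : Finset (Sym2 V), IsMatching G M ∧ M.card = n}

/-- The minimum matching number `min-match(G)`:
minimum size of a maximal matching of `G`. -/
def minMatchNum (G : SimpleGraph V) : ℕ :=
  sInf {n | ∃ M : Finset (Sym2 V), IsMaximalMatching G M ∧ M.card = n}

/-- The induced matching number `ind-match(G)`:
maximum size of an induced matching of `G`. -/
def indMatchNum (G : SimpleGraph V) : ℕ :=
  sSup {n | ∃ M : Finset (Sym2 V), IsInducedMatching G M ∧ M.card = n}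

/-- The edge ideal `I(G) ⊆ K[x_v : v ∈ V]`, generated by the products
`x_i * x_j` over the edges `{x_i, x_j}` of `G`. -/
def edgeIdeal (K : Type) [Field K] (G : SimpleGraph V) : Ideal (MvPolynomial V K) :=
  Ideal.span {p | ∃ i j : V, G.Adj i j ∧ p = X i * X j}

/-- `dim(G)`: the Krull dimension of the quotient ring `K[V(G)]/I(G)`. -/
def graphDim (K : Type) [Field K] (G : SimpleGraph V) : WithBot ℕ∞ :=
  ringKrullDim (MvPolynomial V K ⧸ edgeIdeal K G)

/-! ### Krull dimension of the edge ideal -/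

lemma card_le_graphDim [Finite V] (K : Type) [Field K] (G : SimpleGraph V) (S : Finset V)
    (hS : G.IsIndepSet (S : Set V)) : ((S.card : ℕ) : WithBot ℕ∞) ≤ graphDim K G := by
  let φ : MvPolynomial V K →ₐ[K] MvPolynomial S K :=
    aeval fun v => if h : v ∈ S then X ⟨v, h⟩ else 0
  have hφ : ∀ p ∈ edgeIdeal K G, φ.toRingHom p = 0 := by
    intro p hp
    have hle : edgeIdeal K G ≤ RingHom.ker φ.toRingHom := by
      refine Ideal.span_le.2 ?_
      rintro _ ⟨i, j, hij, rfl⟩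
      by_cases hi : i ∈ S
      · by_cases hj : j ∈ S
        · exact absurd hij (hS hi hj hij.ne)
        · simp [φ, hj]
      · simp [φ, hi]
    exact hle hp
  have hsurj : Function.Surjective φ.toRingHom := by
    have h : φ.comp (rename ((↑) : S → V)) = AlgHom.id K _ := by
      ext v
      simp [φ]
    intro p
    exact ⟨rename ((↑) : S → V) p, DFunLike.congr_fun h p⟩
  have h := ringKrullDim_le_of_surjective (Ideal.Quotient.lift _ φ.toRingHom hφ)
    (Ideal.Quotient.lift_surjective_of_surjective _ _ hsurj)
  rwa [MvPolynomial.ringKrullDim_of_isNoetherianRing, ringKrullDim_eq_zero_of_field, zero_add,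
    Nat.card_eq_fintype_card, Fintype.card_coe] at h

lemma ringKrullDim_quotient_le_of_X_mem [Finite V] (K : Type) [Field K]
    (P : Ideal (MvPolynomial V K)) (T : Finset V) (hT : ∀ v ∉ T, X v ∈ P) :
    ringKrullDim (MvPolynomial V K ⧸ P) ≤ ((T.card : ℕ) : WithBot ℕ∞) := by
  let ψ : MvPolynomial T K →ₐ[K] MvPolynomial V K ⧸ P :=
    (Ideal.Quotient.mkₐ K P).comp (rename ((↑) : T → V))
  let χ : MvPolynomial V K →ₐ[K] MvPolynomial T K :=
    aeval fun v => if h : v ∈ T then X ⟨v, h⟩ else 0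
  have h : ψ.comp χ = Ideal.Quotient.mkₐ K P := by
    ext v
    by_cases hv : v ∈ T
    · simp [ψ, χ, hv]
    · simpa [ψ, χ, hv] using (Ideal.Quotient.eq_zero_iff_mem.2 (hT v hv)).symm
  have hsurj : Function.Surjective ψ := by
    intro q
    obtain ⟨p, rfl⟩ := Ideal.Quotient.mk_surjective q
    exact ⟨χ p, DFunLike.congr_fun h p⟩
  have h := ringKrullDim_le_of_surjective ψ.toRingHom hsurj
  rwa [MvPolynomial.ringKrullDim_of_isNoetherianRing, ringKrullDim_eq_zero_of_field, zero_add,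
    Nat.card_eq_fintype_card, Fintype.card_coe] at h

lemma graphDim_le [Fintype V] (K : Type) [Field K] (G : SimpleGraph V) (d : ℕ)
    (hd : ∀ S : Finset V, G.IsIndepSet (S : Set V) → S.card ≤ d) :
    graphDim K G ≤ (d : WithBot ℕ∞) := by
  rw [graphDim, ringKrullDim_quotient]
  refine iSup_le fun l => ?_
  let P := l.head.1
  let T : Finset V := Finset.univ.filter fun v => X v ∉ P.asIdeal
  have hT : G.IsIndepSet (T : Set V) := by
    intro i hi j hj _ hij
    have hmem : (X i * X j : MvPolynomial V K) ∈ P.asIdeal :=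
      l.head.2 (Ideal.subset_span ⟨i, j, hij, rfl⟩)
    rcases P.2.mem_or_mem hmem with h | h
    · exact (Finset.mem_filter.1 hi).2 h
    · exact (Finset.mem_filter.1 hj).2 h
  let l' : LTSeries (PrimeSpectrum.zeroLocus (R := MvPolynomial V K) P.asIdeal) :=
    { length := l.length
      toFun := fun i => ⟨(l i).1, (PrimeSpectrum.asIdeal_le_asIdeal _ _).2
        (show l.head.1 ≤ (l i).1 from l.head_le i)⟩
      step := fun i => l.step i }
  have h1 : ((l.length : ℕ) : WithBot ℕ∞) ≤ ringKrullDim (MvPolynomial V K ⧸ P.asIdeal) := by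
    rw [ringKrullDim_quotient]
    exact Order.LTSeries.length_le_krullDim l'
  have h2 := ringKrullDim_quotient_le_of_X_mem K P.asIdeal T fun v hv => by
    simpa [T] using hv
  exact (h1.trans h2).trans (by exact_mod_cast hd T hT)

/-! ### Generalities on matchings -/

lemma IsMatching.eq_of_mem {G : SimpleGraph V} {M : Finset (Sym2 V)} (hM : IsMatching G M)
    {e f : Sym2 V} (he : e ∈ M) (hf : f ∈ M) {v : V} (hve : v ∈ e) (hvf : v ∈ f) : e = f :=
  not_not.1 fun h => hM.2 e he f hf h v hve hvf

lemma IsMatching.subset {G : SimpleGraph V} {M N : Finset (Sym2 V)} (hM : IsMatching G M)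
    (h : N ⊆ M) : IsMatching G N :=
  ⟨fun _ he => hM.1 (h he), fun e he f hf => hM.2 e (h he) f (h hf)⟩

/-- The set of vertices covered by a set of edges. -/
def cover (M : Finset (Sym2 V)) : Finset V := M.biUnion Sym2.toFinset

lemma mem_cover {M : Finset (Sym2 V)} {v : V} : v ∈ cover M ↔ ∃ e ∈ M, v ∈ e := by
  simp [cover]

lemma card_cover_le (M : Finset (Sym2 V)) : (cover M).card ≤ 2 * M.card := by
  rw [mul_comm]
  refine Finset.card_biUnion_le_card_mul _ _ _ fun e _ => ?_
  rw [Sym2.card_toFinset]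
  split_ifs <;> omega

lemma IsMatching.card_cover {G : SimpleGraph V} {M : Finset (Sym2 V)} (hM : IsMatching G M) :
    (cover M).card = 2 * M.card := by
  rw [cover, Finset.card_biUnion, Finset.sum_congr rfl fun e he =>
    Sym2.card_toFinset_of_not_isDiag e (G.not_isDiag_of_mem_edgeSet (hM.1 he)), Finset.sum_const,
    smul_eq_mul, mul_comm]
  intro e he f hf hef
  refine Finset.disjoint_left.2 fun v hv hv' => ?_
  exact hM.2 e he f hf hef v (Sym2.mem_toFinset.1 hv) (Sym2.mem_toFinset.1 hv')

lemma IsMaximalMatching.mem_cover_or {G : SimpleGraph V} {M : Finset (Sym2 V)}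
    (hM : IsMaximalMatching G M) {u v : V} (h : G.Adj u v) : u ∈ cover M ∨ v ∈ cover M := by
  by_contra! hc
  have hout : ∀ e ∈ M, ∀ w ∈ e, w ∉ s(u, v) := by
    intro e he w hw hw'
    rcases Sym2.mem_iff.1 hw' with rfl | rfl
    · exact hc.1 (mem_cover.2 ⟨e, he, hw⟩)
    · exact hc.2 (mem_cover.2 ⟨e, he, hw⟩)
  refine hM.2 s(u, v) h (fun hmem => hout _ hmem u (by simp) (by simp)) ⟨?_, ?_⟩
  · intro e he
    rcases Finset.mem_insert.1 he with rfl | he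
    · exact h
    · exact hM.1.1 he
  · intro e he f hf hef w hwe hwf
    rcases Finset.mem_insert.1 he with rfl | he <;> rcases Finset.mem_insert.1 hf with rfl | hf
    · exact hef rfl
    · exact hout f hf w hwf hwe
    · exact hout e he w hwe hwf
    · exact hM.1.2 e he f hf hef w hwe hwf

lemma IsMatching.isMaximalMatching {G : SimpleGraph V} {M : Finset (Sym2 V)}
    (hM : IsMatching G M) (h : ∀ u v, G.Adj u v → u ∈ cover M ∨ v ∈ cover M) :
    IsMaximalMatching G M := by
  refine ⟨hM, fun e he heM hins => ?_⟩
  obtain ⟨w, hwe, hw⟩ : ∃ w ∈ e, w ∈ cover M := by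
    induction e with
    | h u v => rcases h u v he with h | h <;> exact ⟨_, by simp, h⟩
  obtain ⟨f, hf, hwf⟩ := mem_cover.1 hw
  obtain rfl := hins.eq_of_mem (Finset.mem_insert_self _ _) (Finset.mem_insert_of_mem hf) hwe hwf
  exact heM hf

lemma isMatching_empty (G : SimpleGraph V) : IsMatching G ∅ := by simp [IsMatching]

lemma IsMaximalMatching.minMatchNum_le {G : SimpleGraph V} {M : Finset (Sym2 V)}
    (hM : IsMaximalMatching G M) :
    minMatchNum G ≤ M.card :=
  Nat.sInf_le ⟨M, hM, rfl⟩

section Finite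

variable [Finite V] (G : SimpleGraph V)

lemma bddAbove_card_of (p : Finset (Sym2 V) → Prop) :
    BddAbove {n | ∃ M : Finset (Sym2 V), p M ∧ M.card = n} := by
  refine (Set.finite_range (Finset.card : Finset (Sym2 V) → ℕ)).bddAbove.mono ?_
  rintro _ ⟨M, -, rfl⟩
  exact ⟨M, rfl⟩

lemma exists_card_eq_matchNum : ∃ M, IsMatching G M ∧ M.card = matchNum G :=
  Nat.sSup_mem (s := {n | ∃ M, IsMatching G M ∧ M.card = n})
     ⟨0, ∅, isMatching_empty G, rfl⟩ (bddAbove_card_of _)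

lemma exists_card_eq_indMatchNum : ∃ M, IsInducedMatching G M ∧ M.card = indMatchNum G :=
  Nat.sSup_mem (s := {n | ∃ M, IsInducedMatching G M ∧ M.card = n})
     ⟨0, ∅, ⟨isMatching_empty G, by simp⟩, rfl⟩ (bddAbove_card_of _)

variable {G}

lemma IsMatching.card_le_matchNum {M : Finset (Sym2 V)} (hM : IsMatching G M) :
    M.card ≤ matchNum G :=
  le_csSup (bddAbove_card_of _) ⟨M, hM, rfl⟩

lemma IsInducedMatching.card_le_indMatchNum {M : Finset (Sym2 V)} (hM : IsInducedMatching G M) :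
    M.card ≤ indMatchNum G :=
  le_csSup (bddAbove_card_of _) ⟨M, hM, rfl⟩

variable (G)

lemma exists_card_eq_minMatchNum : ∃ M, IsMaximalMatching G M ∧ M.card = minMatchNum G := by
  obtain ⟨M, hM, hc⟩ := exists_card_eq_matchNum G
  refine Nat.sInf_mem (s := {n | ∃ M, IsMaximalMatching G M ∧ M.card = n})
    ⟨M.card, M, ⟨hM, fun e _ he h => ?_⟩, rfl⟩
  have := h.card_le_matchNum
  rw [Finset.card_insert_of_notMem he] at this
  omega

lemma indMatchNum_le_minMatchNum : indMatchNum G ≤ minMatchNum G := by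
  obtain ⟨N, hN, hNc⟩ := exists_card_eq_indMatchNum G
  obtain ⟨M, hM, hMc⟩ := exists_card_eq_minMatchNum G
  rw [← hNc, ← hMc]
  refine Finset.card_le_card_of_forall_subsingleton (fun e g => ∃ v, v ∈ g ∧ v ∈ e) ?_ ?_
  · intro e he
    obtain ⟨w, hwe, hw⟩ : ∃ w ∈ e, w ∈ cover M := by
      have := hN.1.1 he
      induction e with
      | h u v => rcases hM.mem_cover_or this with h | h <;> exact ⟨_, by simp, h⟩
    obtain ⟨f, hf, hwf⟩ := mem_cover.1 hw
    exact ⟨f, hf, w, hwf, hwe⟩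
  · rintro g hg e ⟨he, hge⟩ e' ⟨he', hge'⟩
    by_contra hne
    exact hN.2 g (hM.1.1 hg) e he e' he' hne ⟨hge, hge'⟩

lemma minMatchNum_le_matchNum : minMatchNum G ≤ matchNum G := by
  obtain ⟨M, hM, hMc⟩ := exists_card_eq_minMatchNum G
  exact hMc ▸ hM.1.card_le_matchNum

lemma matchNum_le_two_mul_minMatchNum : matchNum G ≤ 2 * minMatchNum G := by
  obtain ⟨N, hN, hNc⟩ := exists_card_eq_matchNum G
  obtain ⟨M, hM, hMc⟩ := exists_card_eq_minMatchNum G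
  rw [← hNc, ← hMc]
  refine le_trans ?_ (card_cover_le M)
  refine Finset.card_le_card_of_forall_subsingleton (fun e v => v ∈ e) ?_ ?_
  · intro e he
    have := hN.1 he
    induction e with
    | h u v => rcases hM.mem_cover_or this with h | h <;> exact ⟨_, h, by simp⟩
  · rintro v _ e ⟨he, hve⟩ e' ⟨he', hve'⟩
    exact hN.eq_of_mem he he' hve hve'

end Finite

lemma indMatchNum_le_graphDim [Finite V] (K : Type) [Field K] (G : SimpleGraph V) :
    (indMatchNum G : WithBot ℕ∞) ≤ graphDim K G := by
  obtain ⟨N, hN, hNc⟩ := exists_card_eq_indMatchNum G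
  have hmem : ∀ e : Sym2 V, e.out.1 ∈ e := fun e => e.out_fst_mem
  have hinj : Set.InjOn (fun e : Sym2 V => e.out.1) (N : Set (Sym2 V)) := by
    intro e he f hf h
    exact hN.1.eq_of_mem he hf (hmem e) (by
      have h' : e.out.1 = f.out.1 := h
      exact h' ▸ hmem f)
  rw [← hNc, ← Finset.card_image_of_injOn hinj]
  refine card_le_graphDim K G _ ?_
  intro u hu v hv huv hadj
  obtain ⟨e, he, rfl⟩ := Finset.mem_image.1 hu
  obtain ⟨f, hf, rfl⟩ := Finset.mem_image.1 hv
  refine hN.2 s(e.out.1, f.out.1) hadj e he f hf (fun h => huv (by rw [h])) ⟨?_, ?_⟩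
  · exact ⟨e.out.1, by simp, hmem e⟩
  · exact ⟨f.out.1, by simp, hmem f⟩

lemma two_mul_matchNum_sub_le_graphDim [Fintype V] (K : Type) [Field K] (G : SimpleGraph V) :
    ((2 * (matchNum G - minMatchNum G) : ℕ) : WithBot ℕ∞) ≤ graphDim K G := by
  obtain ⟨N, hN, hNc⟩ := exists_card_eq_matchNum G
  obtain ⟨M, hM, hMc⟩ := exists_card_eq_minMatchNum G
  have h1 := hN.card_cover
  have h2 := (cover N).card_le_univ
  have h3 := card_cover_le M
  have h4 := Finset.card_compl (cover M)
  refine le_trans ?_ (card_le_graphDim K G (cover M)ᶜ ?_)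
  · have : 2 * (matchNum G - minMatchNum G) ≤ (cover M)ᶜ.card := by omega
    exact_mod_cast this
  · intro u hu v hv _ hadj
    rw [Finset.mem_coe, Finset.mem_compl] at hu hv
    rcases hM.mem_cover_or hadj with h | h
    · exact hu h
    · exact hv h

/-- A family of pairwise disjoint edges is a matching of the size of the index type. -/
lemma exists_isMatching_of_family {ι : Type*} [Fintype ι] {G : SimpleGraph V} (E : ι → Sym2 V)
    (hE : ∀ i, E i ∈ G.edgeSet) (hdisj : ∀ i j v, v ∈ E i → v ∈ E j → i = j) :
    ∃ M, IsMatching G M ∧ M.card = Fintype.card ι ∧ ∀ e, e ∈ M ↔ ∃ i, E i = e := by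
  refine ⟨Finset.univ.image E, ⟨?_, ?_⟩, ?_, by simp⟩
  · intro e he
    obtain ⟨i, -, rfl⟩ := Finset.mem_image.1 he
    exact hE i
  · intro e he f hf hef v hve hvf
    obtain ⟨i, -, rfl⟩ := Finset.mem_image.1 he
    obtain ⟨j, -, rfl⟩ := Finset.mem_image.1 hf
    exact hef (by rw [hdisj i j v hve hvf])
  · rw [Finset.card_image_of_injective, Finset.card_univ]
    intro i j h
    exact hdisj i j _ (E i).out_fst_mem (h ▸ (E i).out_fst_mem)

/-- A matching all of whose edges contain `x`, or lie in `A`, or lie in `B`. -/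
lemma IsMatching.card_le_of_barrier {G : SimpleGraph V} {M : Finset (Sym2 V)}
    (hM : IsMatching G M) (x : V) (A B : Finset V)
    (h : ∀ e ∈ M, x ∈ e ∨ (∀ v ∈ e, v ∈ A) ∨ ∀ v ∈ e, v ∈ B) :
    M.card ≤ 1 + A.card / 2 + B.card / 2 := by
  have key : ∀ C : Finset V, (M.filter fun e => ∀ v ∈ e, v ∈ C).card ≤ C.card / 2 := by
    intro C
    have h1 := (hM.subset (M.filter_subset fun e => ∀ v ∈ e, v ∈ C)).card_cover
    have h2 : cover (M.filter fun e => ∀ v ∈ e, v ∈ C) ⊆ C := by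
      intro v hv
      obtain ⟨e, he, hve⟩ := mem_cover.1 hv
      exact (Finset.mem_filter.1 he).2 v hve
    have h3 := Finset.card_le_card h2
    omega
  have hx : (M.filter fun e => x ∈ e).card ≤ 1 := by
    refine Finset.card_le_one.2 fun e he f hf => ?_
    rw [Finset.mem_filter] at he hf
    exact hM.eq_of_mem he.1 hf.1 he.2 hf.2
  have hsub : M ⊆ ((M.filter fun e => x ∈ e) ∪ M.filter fun e => ∀ v ∈ e, v ∈ A) ∪
      M.filter fun e => ∀ v ∈ e, v ∈ B := by
    intro e he
    have := h e he
    simp only [Finset.mem_union, Finset.mem_filter]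
    tauto
  have h1 := Finset.card_le_card hsub
  have h2 := Finset.card_union_le ((M.filter fun e => x ∈ e) ∪ M.filter fun e => ∀ v ∈ e, v ∈ A)
    (M.filter fun e => ∀ v ∈ e, v ∈ B)
  have h3 := Finset.card_union_le (M.filter fun e => x ∈ e) (M.filter fun e => ∀ v ∈ e, v ∈ A)
  have h4 := key A
  have h5 := key B
  omega

/-! ### Disjoint even cliques joined by independent vertices -/

section CliqueGraph

variable {A B Y : Type}

/-- The graph on `(B × Bool) ⊕ Y` in which `B × Bool` induces a disjoint union of cliques, the
cliques being the fibres of `f`, the set `Y` is independent, and the edges between `B × Bool` and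
`Y` are prescribed by `R`. -/
def cliqueGraph (f : B → A) (R : B × Bool → Y → Prop) : SimpleGraph ((B × Bool) ⊕ Y) where
  Adj
    | .inl p, .inl q => p ≠ q ∧ f p.1 = f q.1
    | .inl p, .inr y => R p y
    | .inr y, .inl p => R p y
    | .inr _, .inr _ => False
  symm := ⟨by
    rintro (p | y) (q | z) h
    · exact ⟨h.1.symm, h.2.symm⟩
    · exact h
    · exact h
    · exact h⟩
  loopless := ⟨by
    rintro (p | y) h
    · exact h.1 rfl
    · exact h⟩

variable {f : B → A} {R : B × Bool → Y → Prop}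

lemma not_cliqueGraph_adj_inr_inr {y z : Y} :
    ¬ (cliqueGraph f R).Adj (.inr y) (.inr z) := fun h => h

lemma exists_inl_mem_of_mem_edgeSet {e : Sym2 ((B × Bool) ⊕ Y)}
    (he : e ∈ (cliqueGraph f R).edgeSet) : ∃ p, Sum.inl p ∈ e := by
  induction e with
  | h u v =>
    rcases u with p | y
    · exact ⟨p, by simp⟩
    · rcases v with q | z
      · exact ⟨q, by simp⟩
      · exact False.elim he

lemma eq_of_inl_mem_of_mem_edgeSet {e : Sym2 ((B × Bool) ⊕ Y)}
    (he : e ∈ (cliqueGraph f R).edgeSet) {p q : B × Bool} (hp : Sum.inl p ∈ e)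
    (hq : Sum.inl q ∈ e) : f p.1 = f q.1 := by
  by_cases hpq : p = q
  · rw [hpq]
  · have : e = s(Sum.inl p, Sum.inl q) :=
      (Sym2.mem_and_mem_iff fun h => hpq (Sum.inl_injective h)).1 ⟨hp, hq⟩
    subst this
    exact he.2

lemma indMatchNum_cliqueGraph [Fintype A] [Fintype B] [Fintype Y] (hf : Function.Surjective f) :
    indMatchNum (cliqueGraph f R) = Fintype.card A := by
  refine le_antisymm ?_ ?_
  · obtain ⟨N, hN, hNc⟩ := exists_card_eq_indMatchNum (cliqueGraph f R)
    rw [← hNc, ← Finset.card_univ]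
    refine Finset.card_le_card_of_forall_subsingleton
      (fun e j => ∃ p : B × Bool, Sum.inl p ∈ e ∧ f p.1 = j) ?_ ?_
    · intro e he
      obtain ⟨p, hp⟩ := exists_inl_mem_of_mem_edgeSet (hN.1.1 he)
      exact ⟨f p.1, Finset.mem_univ _, p, hp, rfl⟩
    · rintro j - e ⟨he, p, hp, rfl⟩ e' ⟨he', q, hq, hqp⟩
      by_contra hne
      have hpq : p ≠ q := by
        rintro rfl
        exact hne (hN.1.eq_of_mem he he' hp hq)
      exact hN.2 s(Sum.inl p, Sum.inl q) ⟨hpq, hqp.symm⟩ e he e' he' hne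
        ⟨⟨_, by simp, hp⟩, ⟨_, by simp, hq⟩⟩
  · obtain ⟨g, hg⟩ := hf.hasRightInverse
    let E : A → Sym2 ((B × Bool) ⊕ Y) := fun j => s(Sum.inl (g j, false), Sum.inl (g j, true))
    have hE : ∀ j v, v ∈ E j → ∃ β, v = Sum.inl (g j, β) := by
      intro j v hv
      rcases Sym2.mem_iff.1 hv with rfl | rfl <;> exact ⟨_, rfl⟩
    have hEG : ∀ j, E j ∈ (cliqueGraph f R).edgeSet := fun j => ⟨by simp, rfl⟩
    obtain ⟨M, hM, hc, hME⟩ := exists_isMatching_of_family E hEG (by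
      intro i j v hi hj
      obtain ⟨β, rfl⟩ := hE i v hi
      obtain ⟨γ, h⟩ := hE j _ hj
      simp only [Sum.inl.injEq, Prod.mk.injEq] at h
      exact hg.injective h.1)
    rw [← hc]
    refine IsInducedMatching.card_le_indMatchNum ⟨hM, ?_⟩
    rintro e he e₁ h₁ e₂ h₂ hne ⟨⟨u, hu, hu₁⟩, ⟨v, hv, hv₂⟩⟩
    obtain ⟨i, rfl⟩ := (hME _).1 h₁
    obtain ⟨j, rfl⟩ := (hME _).1 h₂
    obtain ⟨β, rfl⟩ := hE i u hu₁
    obtain ⟨γ, rfl⟩ := hE j v hv₂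
    have := eq_of_inl_mem_of_mem_edgeSet he hu hv
    simp only [hg _] at this
    exact hne (by rw [this])

/-- The perfect matching of the cliques of `cliqueGraph f R`. -/
lemma exists_isMaximalMatching_cliqueGraph [Fintype B] :
    ∃ M, IsMaximalMatching (cliqueGraph f R) M ∧ M.card = Fintype.card B := by
  let E : B → Sym2 ((B × Bool) ⊕ Y) := fun i => s(Sum.inl (i, false), Sum.inl (i, true))
  obtain ⟨M, hM, hc, hME⟩ := exists_isMatching_of_family (G := cliqueGraph f R) E
    (fun i => ⟨by simp, rfl⟩) (by
      intro i j v hi hj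
      rcases Sym2.mem_iff.1 hi with rfl | rfl <;> rcases Sym2.mem_iff.1 hj with h | h <;>
        simp_all)
  have hcov : ∀ p, Sum.inl p ∈ cover M := by
    rintro ⟨i, β⟩
    exact mem_cover.2 ⟨E i, (hME _).2 ⟨i, rfl⟩, by
      cases β <;> simp [E]⟩
  refine ⟨_, hM.isMaximalMatching ?_, hc⟩
  rintro (p | y) v h
  · exact .inl (hcov p)
  · rcases v with q | z
    · exact .inr (hcov q)
    · exact absurd h not_cliqueGraph_adj_inr_inr

lemma minMatchNum_cliqueGraph [Fintype A] [Fintype B] [Fintype Y] :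
    minMatchNum (cliqueGraph f R) = Fintype.card B := by
  refine le_antisymm ?_ ?_
  · obtain ⟨M, hM, hMc⟩ := exists_isMaximalMatching_cliqueGraph (f := f) (R := R)
    exact hMc ▸ hM.minMatchNum_le
  obtain ⟨M, hM, hMc⟩ := exists_card_eq_minMatchNum (cliqueGraph f R)
  rw [← hMc]
  let N : A → Finset (Sym2 ((B × Bool) ⊕ Y)) := fun j =>
    M.filter fun e => ∃ p : B × Bool, Sum.inl p ∈ e ∧ f p.1 = j
  have hN : ∀ j, (Finset.univ.filter fun i => f i = j).card ≤ (N j).card := by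
    intro j
    let Q : Finset ((B × Bool) ⊕ Y) :=
      ((Finset.univ.filter fun i => f i = j) ×ˢ Finset.univ).map Function.Embedding.inl
    have hQ : Q.card = (Finset.univ.filter fun i => f i = j).card * 2 := by
      simp [Q]
    have hmem : ∀ v ∈ Q, ∃ p, f p.1 = j ∧ v = Sum.inl p := by
      intro v hv
      obtain ⟨p, hp, rfl⟩ := Finset.mem_map.1 hv
      simp only [Finset.mem_product, Finset.mem_filter] at hp
      exact ⟨p, hp.1.2, rfl⟩
    have hcov : Q ∩ cover M ⊆ cover (N j) := by
      intro v hv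
      obtain ⟨p, hp, rfl⟩ := hmem v (Finset.mem_inter.1 hv).1
      obtain ⟨e, he, hpe⟩ := mem_cover.1 (Finset.mem_inter.1 hv).2
      exact mem_cover.2 ⟨e, Finset.mem_filter.2 ⟨he, p, hpe, hp⟩, hpe⟩
    have hunc : (Q \ cover M).card ≤ 1 := by
      refine Finset.card_le_one.2 fun u hu v hv => ?_
      rw [Finset.mem_sdiff] at hu hv
      obtain ⟨p, hp, rfl⟩ := hmem u hu.1
      obtain ⟨q, hq, rfl⟩ := hmem v hv.1
      by_contra hne
      have hadj : (cliqueGraph f R).Adj (Sum.inl p) (Sum.inl q) :=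
        ⟨fun h => hne (by rw [h]), hp.trans hq.symm⟩
      rcases hM.mem_cover_or hadj with h | h
      · exact hu.2 h
      · exact hv.2 h
    have h1 := Finset.card_le_card hcov
    have h2 := card_cover_le (N j)
    have h3 := Finset.card_sdiff_add_card_inter Q (cover M)
    omega
  calc Fintype.card B = ∑ j : A, (Finset.univ.filter fun i => f i = j).card := by
        rw [← Finset.card_univ]
        exact Finset.card_eq_sum_card_fiberwise fun _ _ => Finset.mem_univ _
    _ ≤ ∑ j : A, (N j).card := Finset.sum_le_sum fun j _ => hN j
    _ = (Finset.univ.biUnion N).card := by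
        refine (Finset.card_biUnion ?_).symm
        intro i _ j _ hij
        refine Finset.disjoint_left.2 fun e he he' => ?_
        obtain ⟨heM, p, hp, rfl⟩ := Finset.mem_filter.1 he
        obtain ⟨-, q, hq, rfl⟩ := Finset.mem_filter.1 he'
        exact hij (eq_of_inl_mem_of_mem_edgeSet (hM.1.1 heM) hp hq)
    _ ≤ M.card := Finset.card_le_card
        (Finset.biUnion_subset.2 fun j _ => Finset.filter_subset _ _)

end CliqueGraph

/-! ### Adding pendant vertices -/

section Pendants

variable {A B Y : Type} {e : ℕ}

/-- Adds `e` pendant vertices at `x` to the prescribed bipartite part `R`. -/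
def withPendants (R : B × Bool → Y → Prop) (x : B × Bool) (e : ℕ) :
    B × Bool → Y ⊕ Fin e → Prop
  | p, .inl y => R p y
  | p, .inr _ => p = x

variable {f : B → A} {R : B × Bool → Y → Prop} {x : B × Bool}

/-- The independent sets of a graph with pendants at `x` are no larger than expected. -/
lemma card_le_of_isIndepSet_withPendants [Fintype A] [Fintype B] [Fintype Y] {d : ℕ}
    (hA : Fintype.card A ≤ d)
    (hd : ∀ (P : Finset (B × Bool)) (S : Finset Y), S.Nonempty →
      Set.InjOn (fun p => f p.1) (P : Set (B × Bool)) →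
      (∀ p ∈ P, ∀ y ∈ S, ¬ R p y) → P.card + S.card ≤ d)
    (S : Finset ((B × Bool) ⊕ (Y ⊕ Fin e)))
    (hS : (cliqueGraph f (withPendants R x e)).IsIndepSet (S : Set _)) : S.card ≤ d + e := by
  have hinj : Set.InjOn (fun p => f p.1) (S.toLeft : Set (B × Bool)) := by
    intro p hp q hq h
    by_contra hne
    rw [Finset.mem_coe, Finset.mem_toLeft] at hp hq
    exact hS hp hq (fun h => hne (Sum.inl_injective h)) ⟨hne, h⟩
  have hR : ∀ p ∈ S.toLeft, ∀ y ∈ S.toRight.toLeft, ¬ R p y := by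
    intro p hp y hy h
    rw [Finset.mem_toLeft] at hp hy
    exact hS hp (Finset.mem_toRight.1 hy) (by simp) h
  have h1 := S.card_toLeft_add_card_toRight
  have h2 := S.toRight.card_toLeft_add_card_toRight
  have h3 : S.toRight.toRight.card ≤ e := by
    simpa using S.toRight.toRight.card_le_univ
  have h4 : S.toLeft.card ≤ Fintype.card A := by
    rw [← Finset.card_image_of_injOn hinj]
    exact Finset.card_le_univ _
  rcases S.toRight.toLeft.eq_empty_or_nonempty with h | h
  · rw [h, Finset.card_empty] at h2
    omega
  · have := hd _ _ h hinj hR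
    omega

/-- One vertex of each clique together with the pendants. -/
lemma exists_isIndepSet_withPendants [Fintype A] (hf : Function.Surjective f)
    (hx : x.2 = false) :
    ∃ S : Finset ((B × Bool) ⊕ (Y ⊕ Fin e)),
      (cliqueGraph f (withPendants R x e)).IsIndepSet (S : Set _) ∧
        S.card = Fintype.card A + e := by
  obtain ⟨g, hg⟩ := hf.hasRightInverse
  have hinj : Function.Injective fun j => (g j, true) := fun i j h =>
    hg.injective (Prod.ext_iff.1 h).1
  refine ⟨(Finset.univ.map ⟨_, hinj⟩).disjSum
    ((∅ : Finset Y).disjSum (Finset.univ : Finset (Fin e))), ?_, by simp⟩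
  rintro (p | y | i) hp (q | z | j) hq - hadj
  · simp only [Finset.mem_coe, Finset.inl_mem_disjSum, Finset.mem_map, Finset.mem_univ, true_and,
      Function.Embedding.coeFn_mk] at hp hq
    obtain ⟨i, rfl⟩ := hp
    obtain ⟨j, rfl⟩ := hq
    have h : f (g i) = f (g j) := hadj.2
    rw [hg, hg] at h
    exact hadj.1 (by rw [h])
  · simp at hq
  · simp only [Finset.mem_coe, Finset.inl_mem_disjSum, Finset.mem_map, Finset.mem_univ, true_and,
      Function.Embedding.coeFn_mk] at hp
    obtain ⟨i, rfl⟩ := hp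
    have h : (g i, true) = x := hadj
    simp [← h] at hx
  · simp at hp
  · exact hadj
  · exact hadj
  · simp only [Finset.mem_coe, Finset.inl_mem_disjSum, Finset.mem_map, Finset.mem_univ, true_and,
      Function.Embedding.coeFn_mk] at hq
    obtain ⟨i, rfl⟩ := hq
    have h : (g i, true) = x := hadj
    simp [← h] at hx
  · exact hadj
  · exact hadj

/-- The independent vertices outside the cliques. -/
lemma exists_isIndepSet_withPendants_right [Fintype Y] :
    ∃ S : Finset ((B × Bool) ⊕ (Y ⊕ Fin e)),
      (cliqueGraph f (withPendants R x e)).IsIndepSet (S : Set _) ∧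
        S.card = Fintype.card Y + e := by
  refine ⟨(∅ : Finset (B × Bool)).disjSum Finset.univ, ?_, by simp⟩
  rintro (p | y) hp (q | z) hq - hadj
  · simp at hp
  · simp at hp
  · simp at hq
  · exact hadj

/-- Upper bound for the matching number: every edge contains `x`, or lies in `P ∪ S`, or lies in
`P' ∪ S'`. -/
lemma matchNum_withPendants_le [Fintype B] [Fintype Y] (P P' : Finset (B × Bool))
    (S S' : Finset Y)
    (hP : ∀ p q, p ≠ x → q ≠ x → f p.1 = f q.1 → p ∈ P ∧ q ∈ P ∨ p ∈ P' ∧ q ∈ P')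
    (hS : ∀ p y, p ≠ x → R p y → p ∈ P ∧ y ∈ S ∨ p ∈ P' ∧ y ∈ S') :
    matchNum (cliqueGraph f (withPendants R x e)) ≤
      1 + (P.card + S.card) / 2 + (P'.card + S'.card) / 2 := by
  obtain ⟨M, hM, hMc⟩ := exists_card_eq_matchNum (cliqueGraph f (withPendants R x e))
  rw [← hMc]
  have h := hM.card_le_of_barrier (Sum.inl x)
    (P.disjSum (S.disjSum ∅)) (P'.disjSum (S'.disjSum ∅)) ?_
  · simpa using h
  intro g hg
  have hadj := hM.1 hg
  induction g with
  | h u v =>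
    by_cases hu : u = Sum.inl x
    · simp [hu]
    by_cases hv : v = Sum.inl x
    · simp [hv]
    right
    rcases u with p | y | i <;> rcases v with q | z | j
    · have := hP p q (fun h => hu (by rw [h])) (fun h => hv (by rw [h])) hadj.2
      simpa using this
    · have := hS p z (fun h => hu (by rw [h])) hadj
      simpa using this
    · exact absurd (congrArg Sum.inl hadj) hu
    · have := hS q y (fun h => hv (by rw [h])) hadj
      simpa [and_comm] using this
    · exact absurd hadj id
    · exact absurd hadj id
    · exact absurd (congrArg Sum.inl hadj) hv
    · exact absurd hadj id
    · exact absurd hadj id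

end Pendants

section Realization

variable {A : Type} {b e : ℕ} {f : Fin b → A} {x : Fin b × Bool}

/-- If `2k` independent vertices are joined to everything else, they can be matched simultaneously
with `k` of the pairs `{i} × Bool`, while the other pairs are edges. -/
lemma exists_isMatching_withPendants_top {k : ℕ} (hk : k ≤ b) :
    ∃ M, IsMatching (cliqueGraph f
      (withPendants (fun _ (_ : Fin k × Bool) => True) x e)) M ∧ M.card = b + k := by
  let E : Fin b ⊕ Fin k → Sym2 ((Fin b × Bool) ⊕ ((Fin k × Bool) ⊕ Fin e))
    | .inl i => if h : (i : ℕ) < k then s(.inl (i, false), .inr (.inl (⟨i, h⟩, false)))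
        else s(.inl (i, false), .inl (i, true))
    | .inr c => s(.inl (c.castLE hk, true), .inr (.inl (c, true)))
  let owner : (Fin b × Bool) ⊕ ((Fin k × Bool) ⊕ Fin e) → Fin b ⊕ Fin k
    | .inl (i, false) => .inl i
    | .inl (i, true) => if h : (i : ℕ) < k then .inr ⟨i, h⟩ else .inl i
    | .inr (.inl (c, false)) => .inl (c.castLE hk)
    | .inr (.inl (c, true)) => .inr c
    | .inr (.inr _) => .inl x.1
  have howner : ∀ i v, v ∈ E i → owner v = i := by
    rintro (i | c) v hv
    · by_cases h : (i : ℕ) < k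
      · simp only [E, h, dif_pos] at hv
        rcases Sym2.mem_iff.1 hv with rfl | rfl
        · rfl
        · simp [owner, Fin.castLE]
      · simp only [E, h, dif_neg, not_false_eq_true] at hv
        rcases Sym2.mem_iff.1 hv with rfl | rfl
        · rfl
        · simp [owner, h]
    · rcases Sym2.mem_iff.1 hv with rfl | rfl
      · simp [owner]
      · rfl
  have hE : ∀ i, E i ∈ (cliqueGraph f
      (withPendants (fun _ (_ : Fin k × Bool) => True) x e)).edgeSet := by
    rintro (i | c)
    · by_cases h : (i : ℕ) < k
      · simp only [E, h, dif_pos]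
        exact trivial
      · simp only [E, h, dif_neg, not_false_eq_true]
        exact ⟨by simp, rfl⟩
    · exact trivial
  obtain ⟨M, hM, hc, -⟩ := exists_isMatching_of_family E hE
    fun i j v hi hj => (howner i v hi).symm.trans (howner j v hj)
  exact ⟨M, hM, by simpa using hc⟩

lemma exists_graph_of_pos [Fintype A] (hf : Function.Surjective f) (hx : x.2 = false) {k : ℕ}
    (hk : 0 < k) (hkb : k ≤ b) (e : ℕ) (K : Type) [Field K] :
    ∃ (V : Type) (_ : Fintype V) (G : SimpleGraph V), G.Connected ∧
      indMatchNum G = Fintype.card A ∧ minMatchNum G = b ∧ matchNum G = b + k ∧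
      graphDim K G = ((max (Fintype.card A) (2 * k) + e : ℕ) : WithBot ℕ∞) := by
  let R : Fin b × Bool → Fin k × Bool → Prop := fun _ _ => True
  refine ⟨_, inferInstance, cliqueGraph f (withPendants R x e), ?_, indMatchNum_cliqueGraph hf,
    minMatchNum_cliqueGraph.trans (Fintype.card_fin b), le_antisymm ?_ ?_, le_antisymm ?_ ?_⟩
  · have hy : ∀ y, (cliqueGraph f (withPendants R x e)).Adj (.inl x) (.inr (.inl y)) :=
      fun _ => trivial
    refine (SimpleGraph.connected_iff_exists_forall_reachable _).2 ⟨.inl x, ?_⟩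
    rintro (p | y | i)
    · have h : (cliqueGraph f (withPendants R x e)).Adj (.inr (.inl (⟨0, hk⟩, true))) (.inl p) :=
        trivial
      exact (hy _).reachable.trans h.reachable
    · exact (hy y).reachable
    · have h : (cliqueGraph f (withPendants R x e)).Adj (.inl x) (.inr (.inr i)) := rfl
      exact h.reachable
  · have h := matchNum_withPendants_le (f := f) (R := R) (x := x) (e := e)
      (Finset.univ.erase x) ∅ Finset.univ ∅ (by simp_all) (by simp_all)
    have hb : 0 < b := x.1.pos
    simp only [Finset.card_erase_of_mem (Finset.mem_univ _), Finset.card_univ, Fintype.card_prod,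
      Fintype.card_fin, Fintype.card_bool, Finset.card_empty] at h
    omega
  · obtain ⟨M, hM, hMc⟩ := exists_isMatching_withPendants_top (f := f) (x := x) (e := e) hkb
    exact hMc ▸ hM.card_le_matchNum
  · refine graphDim_le K _ _ fun S hS =>
      card_le_of_isIndepSet_withPendants (le_max_left _ _) ?_ S hS
    rintro P S ⟨y, hy⟩ - hPS
    have hP : P = ∅ := Finset.eq_empty_of_forall_notMem fun p hp => hPS p hp y hy trivial
    have hS := S.card_le_univ
    simp only [Fintype.card_prod, Fintype.card_fin, Fintype.card_bool] at hS
    rw [hP, Finset.card_empty]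
    omega
  · rcases max_choice (Fintype.card A) (2 * k) with h | h
    · obtain ⟨S, hS, hSc⟩ := exists_isIndepSet_withPendants (R := R) (e := e) hf hx
      rw [h, ← hSc]
      exact card_le_graphDim K _ S hS
    · obtain ⟨S, hS, hSc⟩ :=
        exists_isIndepSet_withPendants_right (f := f) (R := R) (x := x) (e := e)
      have hSc' : S.card = 2 * k + e := by
        simpa [mul_comm] using hSc
      rw [h, ← hSc']
      exact card_le_graphDim K _ S hS

lemma exists_graph_of_matchNum_eq [Fintype A] (hf : Function.Surjective f) (hx : x.2 = false)
    (e : ℕ) (K : Type) [Field K] :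
    ∃ (V : Type) (_ : Fintype V) (G : SimpleGraph V), G.Connected ∧
      indMatchNum G = Fintype.card A ∧ minMatchNum G = b ∧ matchNum G = b ∧
      graphDim K G = ((Fintype.card A + e : ℕ) : WithBot ℕ∞) := by
  let Y : Type := {_u : Unit // 2 ≤ Fintype.card A}
  let R : Fin b × Bool → Y → Prop := fun p _ => p = x ∨ f p.1 ≠ f x.1
  have hY : Fintype.card Y ≤ 1 := Fintype.card_le_one_iff_subsingleton.2 inferInstance
  refine ⟨_, inferInstance, cliqueGraph f (withPendants R x e), ?_, indMatchNum_cliqueGraph hf,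
    minMatchNum_cliqueGraph.trans (Fintype.card_fin b), le_antisymm ?_ ?_, le_antisymm ?_ ?_⟩
  · have hy : ∀ y, (cliqueGraph f (withPendants R x e)).Adj (.inl x) (.inr (.inl y)) :=
      fun _ => .inl rfl
    refine (SimpleGraph.connected_iff_exists_forall_reachable _).2 ⟨.inl x, ?_⟩
    rintro (p | y | i)
    · by_cases hp : f p.1 = f x.1
      · by_cases hpx : p = x
        · rw [hpx]
        · have h : (cliqueGraph f (withPendants R x e)).Adj (.inl x) (.inl p) :=
            ⟨fun h => hpx h.symm, hp.symm⟩
          exact h.reachable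
      · have hA : 2 ≤ Fintype.card A := Fintype.one_lt_card_iff.2 ⟨_, _, hp⟩
        have h : (cliqueGraph f (withPendants R x e)).Adj (.inr (.inl ⟨(), hA⟩)) (.inl p) :=
          .inr hp
        exact (hy _).reachable.trans h.reachable
    · exact (hy y).reachable
    · have h : (cliqueGraph f (withPendants R x e)).Adj (.inl x) (.inr (.inr i)) := rfl
      exact h.reachable
  · let F : Finset (Fin b) := Finset.univ.filter fun i => f i = f x.1
    let F' : Finset (Fin b) := Finset.univ.filter fun i => ¬ f i = f x.1
    have hxF : x ∈ F ×ˢ (Finset.univ : Finset Bool) := by simp [F]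
    have h := matchNum_withPendants_le (f := f) (R := R) (x := x) (e := e)
      ((F ×ˢ Finset.univ).erase x) (F' ×ˢ Finset.univ) ∅ Finset.univ
      (by
        intro p q hp hq hpq
        by_cases h : f p.1 = f x.1
        · simp [F, hp, hq, ← hpq, h]
        · simp [F', ← hpq, h])
      (by
        rintro p y hp (h | h)
        · exact absurd h hp
        · simp [F', h])
    have hF : F.card + F'.card = b := by
      simpa using Finset.card_filter_add_card_filter_not
        (s := (Finset.univ : Finset (Fin b))) (fun i => f i = f x.1)
    have hpos : 0 < F.card := Finset.card_pos.2 ⟨x.1, by simp [F]⟩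
    simp only [Finset.card_erase_of_mem hxF, Finset.card_product, Finset.card_univ,
      Fintype.card_bool, Finset.card_empty] at h
    omega
  · obtain ⟨M, hM, hMc⟩ :=
      exists_isMaximalMatching_cliqueGraph (f := f) (R := withPendants R x e)
    rw [Fintype.card_fin] at hMc
    exact hMc.ge.trans hM.1.card_le_matchNum
  · refine graphDim_le K _ _ fun S hS => card_le_of_isIndepSet_withPendants le_rfl ?_ S hS
    rintro P S ⟨y, hy⟩ hinj hPS
    have hP : P.card ≤ 1 := by
      refine Finset.card_le_one.2 fun p hp q hq => hinj hp hq ?_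
      have h1 := hPS p hp y hy
      have h2 := hPS q hq y hy
      simp only [R, not_or, not_not] at h1 h2
      exact h1.2.trans h2.2.symm
    have hS := S.card_le_univ.trans hY
    have := y.2
    omega
  · obtain ⟨S, hS, hSc⟩ := exists_isIndepSet_withPendants (R := R) (e := e) hf hx
    rw [← hSc]
    exact card_le_graphDim K _ S hS

end Realization

lemma exists_surjective_fin {a b : ℕ} (ha : 0 < a) (hab : a ≤ b) :
    ∃ f : Fin b → Fin a, Function.Surjective f := by
  have : NeZero a := ⟨ha.ne'⟩
  exact ⟨_, Function.invFun_surjective (Fin.castLE_injective hab)⟩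

/-- **Theorem (main)**: for positive integers `a, b, c, d`, there exists a finite
connected simple graph `G` with `ind-match(G) = a`, `min-match(G) = b`,
`match(G) = c` and `dim(G) = d` if and only if
`1 ≤ a ≤ b ≤ c ≤ 2b` and `d ≥ max {a, 2(c - b)}`. -/
theorem main_theorem (a b c d : ℕ) (ha : 1 ≤ a) (hb : 1 ≤ b) (hc : 1 ≤ c)
    (hd : 1 ≤ d) (K : Type) [Field K] :
    (∃ (V : Type) (_ : Fintype V) (G : SimpleGraph V), G.Connected ∧
        indMatchNum G = a ∧ minMatchNum G = b ∧ matchNum G = c ∧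
        graphDim K G = (d : WithBot ℕ∞)) ↔
      (a ≤ b ∧ b ≤ c ∧ c ≤ 2 * b ∧ max a (2 * (c - b)) ≤ d) := by
  constructor
  · rintro ⟨V, _, G, -, rfl, rfl, rfl, hdim⟩
    refine ⟨indMatchNum_le_minMatchNum G, minMatchNum_le_matchNum G,
      matchNum_le_two_mul_minMatchNum G, max_le ?_ ?_⟩
    · have h := indMatchNum_le_graphDim K G
      rw [hdim] at h
      exact_mod_cast h
    · have h := two_mul_matchNum_sub_le_graphDim K G
      rw [hdim] at h
      exact_mod_cast h
  · rintro ⟨hab, hbc, hcb, hmax⟩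
    obtain ⟨f, hf⟩ := exists_surjective_fin ha hab
    obtain ⟨e, rfl⟩ := Nat.exists_eq_add_of_le hmax
    obtain ⟨k, rfl⟩ := Nat.exists_eq_add_of_le hbc
    rw [Nat.add_sub_cancel_left]
    rcases k.eq_zero_or_pos with rfl | hk
    · simpa using
        exists_graph_of_matchNum_eq (x := ((⟨0, hb⟩ : Fin b), false)) hf rfl e K
    · simpa using
        exists_graph_of_pos (x := ((⟨0, hb⟩ : Fin b), false)) hf rfl hk (by omega) e K

end EdgeIdealPaper
end
end

section
/- Let G be a finite simple graph on vertex set {x_1, …, x_n} without isolated vertices, and let S be an independent set of G. Then ind-match(G^S) = ind-match(G). -/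
/-!
Formalization of results from "Matching numbers and dimension of edge ideals"
by A. Hirano and K. Matsuda.

For a finite simple graph `G`:
* a matching is a set of pairwise disjoint edges;
* a maximal matching is one that cannot be enlarged by any edge;
* an induced matching is a matching such that no edge of `G` meets two
  distinct edges of the matching;
* `matchNum`, `minMatchNum`, `indMatchNum` are the corresponding maximum,
  minimum-maximal and maximum-induced sizes;
* `graphDim K G` is the Krull dimension of `K[V(G)]/I(G)`, where `I(G)` is
  the edge ideal of `G`.
-/

open MvPolynomial
open scoped Classical

noncomputable section

namespace EdgeIdealPaper

variable {V : Type*}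

/-- The `S`-suspension `G^S` of `G`: a new vertex (here `none : Option V`) is
joined to every vertex of `G` not belonging to `S`. -/
def suspension (G : SimpleGraph V) (S : Set V) : SimpleGraph (Option V) :=
  SimpleGraph.fromRel (fun u w =>
    (∃ i j : V, u = some i ∧ w = some j ∧ G.Adj i j) ∨
    (∃ i : V, i ∉ S ∧ u = some i ∧ w = none))

theorem suspension_adj_some_some (G : SimpleGraph V) (S : Set V) (i j : V) :
    (suspension G S).Adj (some i) (some j) ↔ G.Adj i j := by
  simp only [suspension, SimpleGraph.fromRel_adj]
  constructor
  · rintro ⟨-, (⟨a, b, ha, hb, h⟩ | ⟨a, -, -, h⟩) | (⟨a, b, ha, hb, h⟩ | ⟨a, -, -, h⟩)⟩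
    · cases ha; cases hb; exact h
    · cases h
    · cases ha; cases hb; exact h.symm
    · cases h
  · intro h
    exact ⟨fun e => h.ne (Option.some.inj e), Or.inl (Or.inl ⟨i, j, rfl, rfl, h⟩)⟩

theorem suspension_adj_none_some (G : SimpleGraph V) (S : Set V) (i : V) :
    (suspension G S).Adj none (some i) ↔ i ∉ S := by
  simp [suspension, SimpleGraph.fromRel_adj]

theorem map_some_mem_edgeSet_suspension (G : SimpleGraph V) (S : Set V) (e : Sym2 V) :
    e.map some ∈ (suspension G S).edgeSet ↔ e ∈ G.edgeSet := by
  induction e with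
  | _ a b => simp [suspension_adj_some_some]

theorem eq_map_some_of_none_notMem {e : Sym2 (Option V)} (he : none ∉ e) :
    ∃ f : Sym2 V, f.map some = e := by
  induction e with
  | _ a b =>
    rcases a with _ | a
    · simp at he
    rcases b with _ | b
    · simp at he
    exact ⟨s(a, b), rfl⟩

theorem some_mem_map_some {v : V} {e : Sym2 V} : some v ∈ e.map some ↔ v ∈ e := by
  simp [Sym2.mem_map]

theorem isMatching_suspension_image_iff (G : SimpleGraph V) (S : Set V)
    (M : Finset (Sym2 V)) :
    IsMatching (suspension G S) (M.image (Sym2.map some)) ↔ IsMatching G M := by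
  have hinj : Function.Injective (Sym2.map (some : V → Option V)) :=
    Sym2.map.injective (Option.some_injective V)
  constructor
  · rintro ⟨hE, hd⟩
    refine ⟨fun e he => (map_some_mem_edgeSet_suspension G S e).1
      (hE (Finset.mem_coe.2 (Finset.mem_image_of_mem _ he))), fun e he f hf hef v hve hvf => ?_⟩
    exact hd _ (Finset.mem_image_of_mem _ he) _ (Finset.mem_image_of_mem _ hf)
      (hinj.ne hef) (some v) (some_mem_map_some.2 hve) (some_mem_map_some.2 hvf)
  · rintro ⟨hE, hd⟩
    constructor
    · intro e he
      obtain ⟨f, hf, rfl⟩ := Finset.mem_image.1 (Finset.mem_coe.1 he)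
      exact (map_some_mem_edgeSet_suspension G S f).2 (hE hf)
    · intro e he f hf hef v hve hvf
      obtain ⟨e, heM, rfl⟩ := Finset.mem_image.1 he
      obtain ⟨f, hfM, rfl⟩ := Finset.mem_image.1 hf
      obtain ⟨v, hv, rfl⟩ := Sym2.mem_map.1 hve
      exact hd e heM f hfM (fun h => hef (h ▸ rfl)) v hv (some_mem_map_some.1 hvf)

theorem isInducedMatching_suspension_image_iff (G : SimpleGraph V) (S : Set V)
    (M : Finset (Sym2 V)) :
    IsInducedMatching (suspension G S) (M.image (Sym2.map some)) ↔ IsInducedMatching G M := by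
  have hinj : Function.Injective (Sym2.map (some : V → Option V)) :=
    Sym2.map.injective (Option.some_injective V)
  rw [IsInducedMatching, IsInducedMatching, isMatching_suspension_image_iff]
  refine and_congr_right fun hM => ?_
  constructor
  · rintro hd e he f hf g hg hfg ⟨⟨v, hve, hvf⟩, w, hwe, hwg⟩
    exact hd _ ((map_some_mem_edgeSet_suspension G S e).2 he)
      _ (Finset.mem_image_of_mem _ hf) _ (Finset.mem_image_of_mem _ hg) (hinj.ne hfg)
      ⟨⟨some v, some_mem_map_some.2 hve, some_mem_map_some.2 hvf⟩,
        some w, some_mem_map_some.2 hwe, some_mem_map_some.2 hwg⟩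
  · rintro hd e he f hf g hg hfg ⟨⟨v, hve, hvf⟩, w, hwe, hwg⟩
    obtain ⟨f, hfM, rfl⟩ := Finset.mem_image.1 hf
    obtain ⟨g, hgM, rfl⟩ := Finset.mem_image.1 hg
    obtain ⟨v, hv, rfl⟩ := Sym2.mem_map.1 hvf
    obtain ⟨w, hw, rfl⟩ := Sym2.mem_map.1 hwg
    have hfg' : f ≠ g := fun h => hfg (h ▸ rfl)
    have hvw : v ≠ w := fun h => hM.2 f hfM g hgM hfg' v hv (h ▸ hw)
    obtain rfl := (Sym2.mem_and_mem_iff ((Option.some_injective V).ne hvw)).1 ⟨hve, hwe⟩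
    exact hd s(v, w) ((suspension_adj_some_some G S v w).1 he) f hfM g hgM hfg'
      ⟨⟨v, Sym2.mem_mk_left v w, hv⟩, w, Sym2.mem_mk_right v w, hw⟩

theorem isInducedMatching_singleton {G : SimpleGraph V} {e : Sym2 V} (he : e ∈ G.edgeSet) :
    IsInducedMatching G {e} := by
  refine ⟨⟨by simpa using he, fun f hf g hg hfg => ?_⟩, fun _ _ f hf g hg hfg => ?_⟩ <;>
  · rw [Finset.mem_singleton] at hf hg
    exact absurd (hf.trans hg.symm) hfg

/-- Every edge of `G` has an endpoint outside the independent set `S`, hence is adjacent to the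
suspension vertex; so an edge at that vertex is alone in any induced matching. -/
theorem IsInducedMatching.eq_singleton_of_none_mem {G : SimpleGraph V} {S : Set V}
    (hS : ∀ v ∈ S, ∀ w ∈ S, ¬ G.Adj v w) {M : Finset (Sym2 (Option V))}
    (hM : IsInducedMatching (suspension G S) M) {e : Sym2 (Option V)} (he : e ∈ M)
    (hne : none ∈ e) : M = {e} := by
  refine Finset.eq_singleton_iff_unique_mem.2 ⟨he, fun f hf => ?_⟩
  by_contra hfe
  obtain ⟨f, rfl⟩ := eq_map_some_of_none_notMem (hM.1.2 e he f hf (Ne.symm hfe) none hne)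
  have hfG : f ∈ G.edgeSet := (map_some_mem_edgeSet_suspension G S f).1 (hM.1.1 hf)
  obtain ⟨v, hv, hvS⟩ : ∃ v ∈ f, v ∉ S := by
    induction f with
    | _ a b =>
      by_cases ha : a ∈ S
      · exact ⟨b, Sym2.mem_mk_right a b, fun hb => hS a ha b hb hfG⟩
      · exact ⟨a, Sym2.mem_mk_left a b, ha⟩
  exact hM.2 s(none, some v) ((suspension_adj_none_some G S v).2 hvS) e he _ hf (Ne.symm hfe)
    ⟨⟨none, Sym2.mem_mk_left _ _, hne⟩,
      some v, Sym2.mem_mk_right _ _, some_mem_map_some.2 hv⟩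

/-- If `G` has no isolated vertices and `S` is an independent set of `G`,
then `ind-match(G^S) = ind-match(G)`. -/
theorem indMatchNum_suspension {V : Type} [Fintype V] (G : SimpleGraph V)
    (hiso : ∀ v : V, ∃ w : V, G.Adj v w) (S : Set V)
    (hS : ∀ v ∈ S, ∀ w ∈ S, ¬ G.Adj v w) :
    indMatchNum (suspension G S) = indMatchNum G := by
  have hinj : Function.Injective (Sym2.map (some : V → Option V)) :=
    Sym2.map.injective (Option.some_injective V)
  unfold indMatchNum
  congr 1
  ext n
  constructor
  · rintro ⟨M, hM, rfl⟩
    by_cases hnone : ∃ e ∈ M, none ∈ e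
    · obtain ⟨e, he, hne⟩ := hnone
      obtain ⟨a, b, hab⟩ : ∃ a b, G.Adj a b := by
        have heE := hM.1.1 he
        obtain ⟨x, rfl⟩ := Sym2.mem_iff_exists.1 hne
        rcases x with _ | a
        · exact absurd heE (suspension G S).irrefl
        · exact ⟨a, hiso a⟩
      refine ⟨{s(a, b)}, isInducedMatching_singleton hab, ?_⟩
      rw [hM.eq_singleton_of_none_mem hS he hne, Finset.card_singleton, Finset.card_singleton]
    · push Not at hnone
      obtain ⟨N, -, rfl⟩ := Finset.subset_set_image_iff.1
        (show (M : Set (Sym2 (Option V))) ⊆ Sym2.map some '' Set.univ from fun e he => by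
          obtain ⟨f, hf⟩ := eq_map_some_of_none_notMem (hnone e he)
          exact ⟨f, Set.mem_univ f, hf⟩)
      exact ⟨N, (isInducedMatching_suspension_image_iff G S N).1 hM,
        (Finset.card_image_of_injective N hinj).symm⟩
  · rintro ⟨N, hN, rfl⟩
    exact ⟨N.image (Sym2.map some), (isInducedMatching_suspension_image_iff G S N).2 hN,
      Finset.card_image_of_injective N hinj⟩

end EdgeIdealPaper
end
end

section
/- Let G be a finite simple graph. Then dim(G) ≥ 2·(match(G) − min-match(G)). -/
/-!
Formalization of results from "Matching numbers and dimension of edge ideals"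
by A. Hirano and K. Matsuda.

For a finite simple graph `G`:
* a matching is a set of pairwise disjoint edges;
* a maximal matching is one that cannot be enlarged by any edge;
* an induced matching is a matching such that no edge of `G` meets two
  distinct edges of the matching;
* `matchNum`, `minMatchNum`, `indMatchNum` are the corresponding maximum,
  minimum-maximal and maximum-induced sizes;
* `graphDim K G` is the Krull dimension of `K[V(G)]/I(G)`, where `I(G)` is
  the edge ideal of `G`.
-/

open MvPolynomial
open scoped Classical

noncomputable section

namespace EdgeIdealPaper

variable {V : Type*}

/-- The finset of vertices covered by a set of edges. -/
def coveredVertices (M : Finset (Sym2 V)) : Finset V :=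
  M.biUnion Sym2.toFinset

lemma mem_coveredVertices {M : Finset (Sym2 V)} {v : V} :
    v ∈ coveredVertices M ↔ ∃ e ∈ M, v ∈ e := by
  simp [coveredVertices]

lemma IsMatching.card_coveredVertices {G : SimpleGraph V} {M : Finset (Sym2 V)}
    (hM : IsMatching G M) : (coveredVertices M).card = 2 * M.card := by
  rw [coveredVertices, Finset.card_biUnion]
  · rw [Finset.sum_congr rfl fun e he => Sym2.card_toFinset_of_not_isDiag e
      (G.not_isDiag_of_mem_edgeSet (hM.1 he))]
    simp [mul_comm]
  · intro e he f hf hef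
    rw [Function.onFun, Finset.disjoint_left]
    intro v hv
    simpa using hM.2 e he f hf hef v (by simpa using hv)

lemma IsMatching.insert_of_notMem_coveredVertices {G : SimpleGraph V} {M : Finset (Sym2 V)}
    (hM : IsMatching G M) {e : Sym2 V} (he : e ∈ G.edgeSet)
    (h : ∀ v ∈ e, v ∉ coveredVertices M) : IsMatching G (insert e M) := by
  simp only [mem_coveredVertices, not_exists, not_and] at h
  refine ⟨?_, ?_⟩
  · rw [Finset.coe_insert]
    exact Set.insert_subset he hM.1
  · intro f hf g hg hfg v hvf hvg
    rw [Finset.mem_insert] at hf hg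
    rcases hf with rfl | hf <;> rcases hg with rfl | hg
    · exact hfg rfl
    · exact h v hvf g hg hvg
    · exact h v hvg f hf hvf
    · exact hM.2 f hf g hg hfg v hvf hvg

lemma IsMaximalMatching.isIndepSet_compl_coveredVertices {G : SimpleGraph V}
    {M : Finset (Sym2 V)} (hM : IsMaximalMatching G M) :
    G.IsIndepSet ((coveredVertices M : Set V)ᶜ) := by
  intro u hu v hv _ huv
  have hu' : u ∉ coveredVertices M := hu
  have hv' : v ∉ coveredVertices M := hv
  refine hM.2 s(u, v) huv (fun he => hu' ?_)
    (hM.1.insert_of_notMem_coveredVertices huv ?_)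
  · exact mem_coveredVertices.2 ⟨_, he, Sym2.mem_mk_left u v⟩
  · intro w hw
    rcases Sym2.mem_iff.1 hw with rfl | rfl
    exacts [hu', hv']

lemma bddAbove_card_isMatching [Fintype V] (G : SimpleGraph V) :
    BddAbove {n | ∃ M : Finset (Sym2 V), IsMatching G M ∧ M.card = n} := by
  refine ⟨Fintype.card (Sym2 V), ?_⟩
  rintro _ ⟨M, -, rfl⟩
  exact M.card_le_univ

lemma exists_isMatching_card_eq_matchNum [Fintype V] (G : SimpleGraph V) :
    ∃ M : Finset (Sym2 V), IsMatching G M ∧ M.card = matchNum G :=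
  Nat.sSup_mem (s := {n | ∃ M : Finset (Sym2 V), IsMatching G M ∧ M.card = n})
    ⟨0, ∅, by simp [IsMatching], rfl⟩ (bddAbove_card_isMatching G)

lemma exists_isMaximalMatching_card_eq_minMatchNum [Fintype V] (G : SimpleGraph V) :
    ∃ M : Finset (Sym2 V), IsMaximalMatching G M ∧ M.card = minMatchNum G := by
  obtain ⟨N, hN, hcard⟩ := exists_isMatching_card_eq_matchNum G
  refine Nat.sInf_mem (s := {n | ∃ M : Finset (Sym2 V), IsMaximalMatching G M ∧ M.card = n})
    ⟨N.card, N, ⟨hN, fun e _ heN hins => ?_⟩, rfl⟩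
  have hle : (insert e N).card ≤ matchNum G :=
    le_csSup (bddAbove_card_isMatching G) ⟨_, hins, rfl⟩
  rw [Finset.card_insert_of_notMem heN] at hle
  omega

/-- The size of an independent set is a lower bound for the dimension of the edge ideal. -/
lemma natCard_le_graphDim_of_isIndepSet {G : SimpleGraph V} {S : Set V} [Finite S]
    (hS : G.IsIndepSet S) (K : Type) [Field K] :
    (Nat.card S : WithBot ℕ∞) ≤ graphDim K G := by
  let φ : MvPolynomial V K →ₐ[K] MvPolynomial S K := killCompl Subtype.val_injective
  have hφ : ∀ p ∈ edgeIdeal K G, φ p = 0 := by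
    suffices h : edgeIdeal K G ≤ RingHom.ker φ from fun p hp => h hp
    refine Ideal.span_le.2 ?_
    rintro _ ⟨i, j, hij, rfl⟩
    have hX : ∀ v ∉ S, φ (X v) = 0 := fun v hv => by simp [φ, killCompl, hv]
    change φ (X i * X j) = 0
    rw [map_mul]
    by_cases hi : i ∈ S
    · rw [hX j fun hj => hS hi hj hij.ne hij, mul_zero]
    · rw [hX i hi, zero_mul]
  have hsurj : Function.Surjective φ := fun p => ⟨rename _ p, killCompl_rename_app _ p⟩
  calc (Nat.card S : WithBot ℕ∞) = ringKrullDim (MvPolynomial S K) := by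
        rw [MvPolynomial.ringKrullDim_of_isNoetherianRing, ringKrullDim_eq_zero_of_field, zero_add]
    _ ≤ graphDim K G :=
        ringKrullDim_le_of_surjective (Ideal.Quotient.lift (edgeIdeal K G) φ.toRingHom hφ)
          (Ideal.Quotient.lift_surjective_of_surjective _ hφ hsurj)

/-- For a finite simple graph `G`, `dim(G) ≥ 2 (match(G) - min-match(G))`. -/
theorem graphDim_ge_two_mul_match_sub_minMatch {V : Type} [Fintype V]
    (G : SimpleGraph V) (K : Type) [Field K] :
    ((2 * (matchNum G - minMatchNum G) : ℕ) : WithBot ℕ∞) ≤ graphDim K G := by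
  obtain ⟨M, hM, hMcard⟩ := exists_isMatching_card_eq_matchNum G
  obtain ⟨N, hN, hNcard⟩ := exists_isMaximalMatching_card_eq_minMatchNum G
  refine le_trans ?_ (natCard_le_graphDim_of_isIndepSet hN.isIndepSet_compl_coveredVertices K)
  have hcompl : Nat.card ((coveredVertices N : Set V)ᶜ : Set V) =
      Fintype.card V - 2 * minMatchNum G := by
    rw [← Finset.coe_compl, Nat.card_coe_set_eq, Set.ncard_coe_finset, Finset.card_compl,
      hN.1.card_coveredVertices, hNcard]
  have hle : 2 * matchNum G ≤ Fintype.card V := by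
    rw [← hMcard, ← hM.card_coveredVertices]
    exact Finset.card_le_univ _
  rw [hcompl]
  exact_mod_cast (by omega :
    2 * (matchNum G - minMatchNum G) ≤ Fintype.card V - 2 * minMatchNum G)

end EdgeIdealPaper
end
end

section
/- Let G be a finite simple graph and W ⊆ V(G) a subset, and let G_W denote the induced subgraph of G on W. Then min-match(G_W) ≤ min-match(G). -/
/-!
Formalization of results from "Matching numbers and dimension of edge ideals"
by A. Hirano and K. Matsuda.

For a finite simple graph `G`:
* a matching is a set of pairwise disjoint edges;
* a maximal matching is one that cannot be enlarged by any edge;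
* an induced matching is a matching such that no edge of `G` meets two
  distinct edges of the matching;
* `matchNum`, `minMatchNum`, `indMatchNum` are the corresponding maximum,
  minimum-maximal and maximum-induced sizes;
* `graphDim K G` is the Krull dimension of `K[V(G)]/I(G)`, where `I(G)` is
  the edge ideal of `G`.
-/

open MvPolynomial
open scoped Classical

noncomputable section

namespace EdgeIdealPaper

variable {V : Type*}

/-- In a finite graph, every matching extends to a maximal one. -/
theorem IsMatching.exists_isMaximalMatching_superset {V : Type*} [Finite V] {G : SimpleGraph V}
    {M : Finset (Sym2 V)} (hM : IsMatching G M) : ∃ N, M ⊆ N ∧ IsMaximalMatching G N := by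
  have : Fintype V := Fintype.ofFinite V
  obtain ⟨N, hMN, hN⟩ :=
    (Set.toFinite {N : Finset (Sym2 V) | IsMatching G N}).exists_le_maximal hM
  exact ⟨N, hMN, hN.prop, fun e _ heN h =>
    heN (hN.le_of_ge h (Finset.subset_insert e N) (Finset.mem_insert_self e N))⟩

/-- Every edge of a graph meets some edge of any maximal matching. -/
theorem IsMaximalMatching.exists_mem_meets {V : Type*} {G : SimpleGraph V}
    {M : Finset (Sym2 V)} (hM : IsMaximalMatching G M) {e : Sym2 V} (he : e ∈ G.edgeSet) :
    ∃ f ∈ M, ∃ v, v ∈ e ∧ v ∈ f := by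
  by_cases heM : e ∈ M
  · exact ⟨e, heM, e.out.1, e.out_fst_mem, e.out_fst_mem⟩
  by_contra! h
  refine hM.2 e he heM ⟨?_, ?_⟩
  · intro f hf
    rcases Finset.mem_insert.1 hf with rfl | hf
    exacts [he, hM.1.1 hf]
  · intro f hf g hg hfg v hvf hvg
    rcases Finset.mem_insert.1 hf with rfl | hfM <;> rcases Finset.mem_insert.1 hg with rfl | hgM
    exacts [hfg rfl, h g hgM v hvf hvg, h f hfM v hvg hvf, hM.1.2 f hfM g hgM hfg v hvf hvg]

/-- The edges of a matching that lie in `W` form a matching of the induced subgraph. -/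
theorem IsMatching.induce {V : Type*} [Fintype V] {G : SimpleGraph V}
    {M : Finset (Sym2 V)} (hM : IsMatching G M) (W : Set V) :
    IsMatching (G.induce W) {e : Sym2 W | e.map (↑) ∈ M} := by
  refine ⟨fun e he => ?_, fun e he f hf hef v hve hvf => ?_⟩
  · have h := hM.1 (Finset.mem_filter.1 he).2
    induction e with
    | h a b => simpa using h
  · exact hM.2 _ (Finset.mem_filter.1 he).2 _ (Finset.mem_filter.1 hf).2
      ((Sym2.map.injective Subtype.val_injective).ne hef) v
      (Sym2.mem_map.2 ⟨v, hve, rfl⟩) (Sym2.mem_map.2 ⟨v, hvf, rfl⟩)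

/-- For an induced subgraph `G_W` of `G`, `min-match(G_W) ≤ min-match(G)`. -/
theorem minMatchNum_induce_le {V : Type} [Fintype V] (G : SimpleGraph V) (W : Set V) :
    minMatchNum (G.induce W) ≤ minMatchNum G := by
  have hne : {n | ∃ M : Finset (Sym2 V), IsMaximalMatching G M ∧ M.card = n}.Nonempty := by
    have h₀ : IsMatching G ∅ := ⟨by simp, by simp⟩
    obtain ⟨N, -, hN⟩ := h₀.exists_isMaximalMatching_superset
    exact ⟨_, N, hN, rfl⟩
  obtain ⟨M, hM, hcard⟩ := Nat.sInf_mem hne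
  obtain ⟨N, hMN, hN⟩ := (hM.1.induce W).exists_isMaximalMatching_superset
  have hle : minMatchNum (G.induce W) ≤ N.card := Nat.sInf_le ⟨N, hN, rfl⟩
  refine hle.trans (le_of_le_of_eq ?_ hcard)
  refine Finset.card_le_card_of_forall_subsingleton
    (fun e f => ∃ v : W, v ∈ e ∧ (v : V) ∈ f) (fun e he => ?_) ?_
  · have hedge : e.map (↑) ∈ G.edgeSet := by
      have h := hN.1.1 he
      induction e with
      | h a b => simpa using h
    obtain ⟨f, hf, v, hve, hvf⟩ := hM.exists_mem_meets hedge
    obtain ⟨w, hwe, rfl⟩ := Sym2.mem_map.1 hve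
    exact ⟨f, hf, w, hwe, hvf⟩
  · rintro f hf e ⟨he, v, hve, hvf⟩ e' ⟨he', v', hve', hvf'⟩
    have eq_of_mem {e e' : Sym2 W} (he : e ∈ N) (he' : e' ∈ N) {v : W} (hv : v ∈ e)
        (hv' : v ∈ e') : e = e' := by
      by_contra hee'
      exact hN.1.2 e he e' he' hee' v hv hv'
    by_cases hvv' : v = v'
    · subst hvv'
      exact eq_of_mem he he' hve hve'
    · have hfW : s(v, v') ∈ N := by
        refine hMN (Finset.mem_filter.2 ⟨Finset.mem_univ _, ?_⟩)
        rw [(Sym2.mem_and_mem_iff (Subtype.val_injective.ne hvv')).1 ⟨hvf, hvf'⟩] at hf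
        simpa using hf
      exact (eq_of_mem he hfW hve (Sym2.mem_mk_left _ _)).trans
        (eq_of_mem he' hfW hve' (Sym2.mem_mk_right _ _)).symm

end EdgeIdealPaper
end
end

section
/- Let G be a finite simple graph and suppose there exist edges {x_i, x_j} and {x_i, x_k} of G with j ≠ k such that the vertices x_j and x_k both have degree 1. Then match(G) = match(G_{V(G)∖{x_k}}), min-match(G) = min-match(G_{V(G)∖{x_k}}), and ind-match(G) = ind-match(G_{V(G)∖{x_k}}), where G_{V(G)∖{x_k}} is the induced subgraph of G on V(G) ∖ {x_k}. -/
/-!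
Formalization of results from "Matching numbers and dimension of edge ideals"
by A. Hirano and K. Matsuda.

For a finite simple graph `G`:
* a matching is a set of pairwise disjoint edges;
* a maximal matching is one that cannot be enlarged by any edge;
* an induced matching is a matching such that no edge of `G` meets two
  distinct edges of the matching;
* `matchNum`, `minMatchNum`, `indMatchNum` are the corresponding maximum,
  minimum-maximal and maximum-induced sizes;
* `graphDim K G` is the Krull dimension of `K[V(G)]/I(G)`, where `I(G)` is
  the edge ideal of `G`.
-/

open MvPolynomial
open scoped Classical

noncomputable section

namespace EdgeIdealPaper

variable {V : Type*}

/-- Two edges meet if they share a vertex. -/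
def Meets (e f : Sym2 V) : Prop := ∃ v : V, v ∈ e ∧ v ∈ f

/-- An embedding of `H` into `G` is faithful on edges if every edge of `G` meets the same
edges of `H` as some edge of `H` does. -/
def IsEdgeFaithful {W V : Type*} {H : SimpleGraph W} {G : SimpleGraph V} (φ : H ↪g G) : Prop :=
  ∀ e ∈ G.edgeSet, ∃ e' ∈ H.edgeSet, ∀ f ∈ H.edgeSet, Meets e' f ↔ Meets e (f.map φ)

/-- The image of a finite set of edges under a graph embedding. -/
def mapEdges {W V : Type*} {H : SimpleGraph W} {G : SimpleGraph V} (φ : H ↪g G)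
    (N : Finset (Sym2 W)) : Finset (Sym2 V) :=
  N.map φ.toEmbedding.sym2Map

section Embedding

variable {W V : Type*} {H : SimpleGraph W} {G : SimpleGraph V} (φ : H ↪g G)

theorem mem_mapEdges {N : Finset (Sym2 W)} {e : Sym2 V} :
    e ∈ mapEdges φ N ↔ ∃ f ∈ N, f.map φ = e :=
  Finset.mem_map

theorem card_mapEdges (N : Finset (Sym2 W)) : (mapEdges φ N).card = N.card :=
  Finset.card_map _

theorem map_mem_edgeSet (e : Sym2 W) : e.map φ ∈ G.edgeSet ↔ e ∈ H.edgeSet := by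
  induction e with
  | _ a b => exact φ.map_adj_iff

theorem meets_map (e f : Sym2 W) : Meets (e.map φ) (f.map φ) ↔ Meets e f := by
  constructor
  · rintro ⟨v, he, hf⟩
    obtain ⟨a, ha, rfl⟩ := Sym2.mem_map.1 he
    obtain ⟨b, hb, hba⟩ := Sym2.mem_map.1 hf
    exact ⟨a, ha, φ.injective hba ▸ hb⟩
  · rintro ⟨v, he, hf⟩
    exact ⟨φ v, Sym2.mem_map.2 ⟨v, he, rfl⟩, Sym2.mem_map.2 ⟨v, hf, rfl⟩⟩

theorem isMatching_iff {M : Finset (Sym2 V)} :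
    IsMatching G M ↔ (∀ e ∈ M, e ∈ G.edgeSet) ∧ ∀ e ∈ M, ∀ f ∈ M, e ≠ f → ¬ Meets e f := by
  simp only [IsMatching, Meets, not_exists, not_and]
  rfl

theorem isMaximalMatching_iff {M : Finset (Sym2 V)} :
    IsMaximalMatching G M ↔ IsMatching G M ∧ ∀ e ∈ G.edgeSet, ∃ f ∈ M, Meets e f := by
  refine and_congr_right fun hM => forall₂_congr fun e he => ?_
  have hsymm : ∀ a b : Sym2 V, Meets a b → Meets b a := fun a b ⟨v, ha, hb⟩ => ⟨v, hb, ha⟩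
  constructor
  · intro h
    by_cases heM : e ∈ M
    · exact ⟨e, heM, e.out.1, e.out_fst_mem, e.out_fst_mem⟩
    · by_contra! hcon
      refine h heM ?_
      rw [isMatching_iff] at hM ⊢
      simp only [Finset.mem_insert]
      grind
  · rintro ⟨f, hf, hef⟩ heM hins
    exact (isMatching_iff.1 hins).2 e (Finset.mem_insert_self _ _) f
      (Finset.mem_insert_of_mem hf) (fun h => heM (h ▸ hf)) hef

theorem isMatching_mapEdges (N : Finset (Sym2 W)) :
    IsMatching G (mapEdges φ N) ↔ IsMatching H N := by
  have hinj : ∀ e f : Sym2 W, e.map φ = f.map φ ↔ e = f := fun e f =>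
    (Sym2.map.injective φ.injective).eq_iff
  simp only [isMatching_iff, mem_mapEdges, forall_exists_index, and_imp,
    forall_apply_eq_imp_iff₂, map_mem_edgeSet, meets_map, ne_eq, hinj]

variable {φ}

theorem IsEdgeFaithful.isMaximalMatching_mapEdges (hφ : IsEdgeFaithful φ)
    (N : Finset (Sym2 W)) : IsMaximalMatching G (mapEdges φ N) ↔ IsMaximalMatching H N := by
  rw [isMaximalMatching_iff, isMaximalMatching_iff, isMatching_mapEdges]
  refine and_congr_right fun hN => ⟨fun h e he => ?_, fun h e he => ?_⟩
  · obtain ⟨_, hf, hef⟩ := h (e.map φ) ((map_mem_edgeSet φ e).2 he)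
    obtain ⟨f, hfN, rfl⟩ := (mem_mapEdges φ).1 hf
    exact ⟨f, hfN, (meets_map φ e f).1 hef⟩
  · obtain ⟨e', he', hmeets⟩ := hφ e he
    obtain ⟨f, hf, hef⟩ := h e' he'
    exact ⟨f.map φ, (mem_mapEdges φ).2 ⟨f, hf, rfl⟩, (hmeets f (hN.1 hf)).1 hef⟩

theorem IsEdgeFaithful.isInducedMatching_mapEdges (hφ : IsEdgeFaithful φ)
    (N : Finset (Sym2 W)) : IsInducedMatching G (mapEdges φ N) ↔ IsInducedMatching H N := by
  unfold IsInducedMatching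
  rw [isMatching_mapEdges]
  refine and_congr_right fun hN => ⟨fun h e he f hf g hg hfg hcon => ?_, fun h e he => ?_⟩
  · exact h (e.map φ) ((map_mem_edgeSet φ e).2 he) (f.map φ) ((mem_mapEdges φ).2 ⟨f, hf, rfl⟩)
      (g.map φ) ((mem_mapEdges φ).2 ⟨g, hg, rfl⟩)
      ((Sym2.map.injective φ.injective).ne hfg)
      ⟨(meets_map φ e f).2 hcon.1, (meets_map φ e g).2 hcon.2⟩
  · obtain ⟨e', he', hmeets⟩ := hφ e he
    intro _ hf _ hg hfg hcon
    obtain ⟨f, hfN, rfl⟩ := (mem_mapEdges φ).1 hf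
    obtain ⟨g, hgN, rfl⟩ := (mem_mapEdges φ).1 hg
    exact h e' he' f hfN g hgN (fun hfg' => hfg (hfg' ▸ rfl))
      ⟨(hmeets f (hN.1 hfN)).2 hcon.1, (hmeets g (hN.1 hgN)).2 hcon.2⟩

theorem isEdgeFaithful_iso (σ : H ≃g G) : IsEdgeFaithful σ.toEmbedding := by
  intro e he
  have hsurj : (e.map σ.symm).map σ.toEmbedding = e := by
    induction e with
    | _ a b => simp
  refine ⟨e.map σ.symm, ?_, fun f _ => ?_⟩
  · rwa [← map_mem_edgeSet σ.toEmbedding, hsurj]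
  · rw [← meets_map σ.toEmbedding, hsurj]

end Embedding

section Pendant

variable {V : Type*} {G : SimpleGraph V} {xi xj xk : V}

theorem adj_iff_of_ncard_neighborSet_eq_one {x y : V} (h : G.Adj x y)
    (hd : (G.neighborSet y).ncard = 1) (v : V) : G.Adj y v ↔ v = x := by
  obtain ⟨a, ha⟩ := Set.ncard_eq_one.1 hd
  have hmem : ∀ w, G.Adj y w ↔ w = a := fun w => by
    rw [← SimpleGraph.mem_neighborSet, ha, Set.mem_singleton_iff]
  rw [hmem, (hmem x).1 h.symm]

/-- Swapping two pendant vertices attached to the same vertex is an automorphism. -/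
def swapPendants (hj : ∀ v, G.Adj xj v ↔ v = xi) (hk : ∀ v, G.Adj xk v ↔ v = xi) : G ≃g G where
  toEquiv := Equiv.swap xj xk
  map_rel_iff' := by
    intro a b
    have hj' : ∀ v, G.Adj v xj ↔ v = xi := fun v => (G.adj_comm v xj).trans (hj v)
    have hk' : ∀ v, G.Adj v xk ↔ v = xi := fun v => (G.adj_comm v xk).trans (hk v)
    have hij : xi ≠ xj := fun h => G.irrefl ((hj xj).2 h.symm)
    have hik : xi ≠ xk := fun h => G.irrefl ((hk xk).2 h.symm)
    simp only [Equiv.swap_apply_def]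
    split_ifs <;> simp_all [hij.symm, hik.symm]

/-- The inclusion of the graph with the vertex `x` deleted. -/
abbrev deleteEmbedding (G : SimpleGraph V) (x : V) : G.induce {v | v ≠ x} ↪g G :=
  SimpleGraph.Embedding.induce {v | v ≠ x}

theorem isEdgeFaithful_deleteEmbedding (hjk : xj ≠ xk) (hj : ∀ v, G.Adj xj v ↔ v = xi)
    (hk : ∀ v, G.Adj xk v ↔ v = xi) : IsEdgeFaithful (deleteEmbedding G xk) := by
  have hik : xi ≠ xk := fun h => G.irrefl ((hk xk).2 h.symm)
  have hlift : ∀ e : Sym2 V, e ∈ G.edgeSet → xk ∉ e →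
      ∃ e' ∈ (G.induce {v | v ≠ xk}).edgeSet, e'.map (deleteEmbedding G xk) = e := by
    intro e he hxe
    induction e with
    | _ a b =>
      rw [Sym2.mem_iff, not_or] at hxe
      exact ⟨s(⟨a, Ne.symm hxe.1⟩, ⟨b, Ne.symm hxe.2⟩), he, rfl⟩
  intro e he
  by_cases hxe : xk ∈ e
  · obtain ⟨y, rfl⟩ := Sym2.mem_iff_exists.1 hxe
    obtain rfl := (hk y).1 he
    obtain ⟨e', he', hmap⟩ := hlift s(y, xj) ((hj y).2 rfl).symm (by simp [hik.symm, hjk.symm])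
    refine ⟨e', he', fun f hf => ?_⟩
    rw [← meets_map (deleteEmbedding G xk), hmap]
    have hfG := (map_mem_edgeSet (deleteEmbedding G xk) f).2 hf
    have hxf : xk ∉ f.map (deleteEmbedding G xk) := by
      rw [Sym2.mem_map]
      rintro ⟨a, -, ha⟩
      exact a.2 ha
    have hjf : xj ∈ f.map (deleteEmbedding G xk) → y ∈ f.map (deleteEmbedding G xk) := by
      generalize f.map (deleteEmbedding G xk) = g at hfG
      intro hg
      obtain ⟨z, rfl⟩ := Sym2.mem_iff_exists.1 hg
      obtain rfl := (hj z).1 hfG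
      exact Sym2.mem_mk_right _ _
    simp only [Meets, Sym2.mem_iff, or_and_right, exists_or, exists_eq_left]
    tauto
  · obtain ⟨e', he', hmap⟩ := hlift e he hxe
    refine ⟨e', he', fun f _ => ?_⟩
    rw [← meets_map (deleteEmbedding G xk), hmap]

theorem exists_mapEdges_deleteEmbedding_eq {x : V} {M : Finset (Sym2 V)} (hM : ∀ e ∈ M, x ∉ e) :
    ∃ N, mapEdges (deleteEmbedding G x) N = M := by
  have hsub : (M : Set (Sym2 V)) ⊆ Set.range (deleteEmbedding G x).toEmbedding.sym2Map := by
    intro e he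
    have hxe := hM e he
    clear he
    induction e with
    | _ a b =>
      rw [Sym2.mem_iff, not_or] at hxe
      exact ⟨s(⟨a, Ne.symm hxe.1⟩, ⟨b, Ne.symm hxe.2⟩), rfl⟩
  rw [← Set.image_univ] at hsub
  obtain ⟨N, -, hN⟩ := Finset.subset_set_image_iff.1 hsub
  exact ⟨N, by rw [mapEdges, Finset.map_eq_image]; convert hN⟩

theorem IsMatching.exists_mapEdges_deleteEmbedding (hjk : xj ≠ xk)
    (hj : ∀ v, G.Adj xj v ↔ v = xi) (hk : ∀ v, G.Adj xk v ↔ v = xi)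
    {M : Finset (Sym2 V)} (hM : IsMatching G M) :
    ∃ N, mapEdges (deleteEmbedding G xk) N = M ∨
      mapEdges (deleteEmbedding G xk) N = mapEdges (swapPendants hj hk).toEmbedding M := by
  by_cases hx : ∀ e ∈ M, xk ∉ e
  · obtain ⟨N, hN⟩ := exists_mapEdges_deleteEmbedding_eq (G := G) hx
    exact ⟨N, Or.inl hN⟩
  · push Not at hx
    obtain ⟨e, he, hxe⟩ := hx
    obtain ⟨y, rfl⟩ := Sym2.mem_iff_exists.1 hxe
    obtain rfl := (hk y).1 (hM.1 he)
    have hjM : ∀ f ∈ M, xj ∉ f := by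
      intro f hf hjf
      obtain ⟨z, rfl⟩ := Sym2.mem_iff_exists.1 hjf
      obtain rfl := (hj z).1 (hM.1 hf)
      exact hM.2 _ he _ hf (fun h => hjk (Sym2.congr_left.1 h).symm) z (Sym2.mem_mk_right _ _)
        (Sym2.mem_mk_right _ _)
    have hswap : ∀ f ∈ mapEdges (swapPendants hj hk).toEmbedding M, xk ∉ f := by
      intro f hf hkf
      obtain ⟨g, hg, rfl⟩ := (mem_mapEdges _).1 hf
      obtain ⟨a, ha, hak⟩ := Sym2.mem_map.1 hkf
      have haj : a = xj :=
        (Equiv.swap xj xk).injective (hak.trans (Equiv.swap_apply_left xj xk).symm)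
      exact hjM g hg (haj ▸ ha)
    obtain ⟨N, hN⟩ := exists_mapEdges_deleteEmbedding_eq (G := G) hswap
    exact ⟨N, Or.inr hN⟩

theorem setOf_card_delete_pendant (hjk : xj ≠ xk)
    (hj : ∀ v, G.Adj xj v ↔ v = xi) (hk : ∀ v, G.Adj xk v ↔ v = xi)
    {P : Finset (Sym2 V) → Prop} {Q : Finset (Sym2 {v | v ≠ xk}) → Prop}
    (hP : ∀ M, P M → IsMatching G M)
    (hσ : ∀ M, P (mapEdges (swapPendants hj hk).toEmbedding M) ↔ P M)
    (hι : ∀ N, P (mapEdges (deleteEmbedding G xk) N) ↔ Q N) :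
    {n | ∃ M, P M ∧ M.card = n} = {n | ∃ N, Q N ∧ N.card = n} := by
  ext n
  constructor
  · rintro ⟨M, hM, rfl⟩
    obtain ⟨N, hN | hN⟩ := (hP M hM).exists_mapEdges_deleteEmbedding hjk hj hk
    · exact ⟨N, (hι N).1 (hN ▸ hM), by rw [← hN, card_mapEdges]⟩
    · refine ⟨N, (hι N).1 (hN ▸ (hσ M).2 hM), ?_⟩
      rw [← card_mapEdges (deleteEmbedding G xk), hN, card_mapEdges]
  · rintro ⟨N, hN, rfl⟩
    exact ⟨_, (hι N).2 hN, card_mapEdges _ N⟩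

end Pendant

/-- If `{x_i, x_j}` and `{x_i, x_k}` are edges of `G` with `x_j ≠ x_k` and both
`x_j` and `x_k` have degree 1, then deleting `x_k` changes none of `match`,
`min-match` and `ind-match`. -/
theorem matching_numbers_delete_pendant {V : Type} [Fintype V] (G : SimpleGraph V)
    (xi xj xk : V) (h1 : G.Adj xi xj) (h2 : G.Adj xi xk) (hjk : xj ≠ xk)
    (hdj : (G.neighborSet xj).ncard = 1) (hdk : (G.neighborSet xk).ncard = 1) :
    matchNum G = matchNum (G.induce {v | v ≠ xk}) ∧
      minMatchNum G = minMatchNum (G.induce {v | v ≠ xk}) ∧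
      indMatchNum G = indMatchNum (G.induce {v | v ≠ xk}) := by
  have hj := adj_iff_of_ncard_neighborSet_eq_one h1 hdj
  have hk := adj_iff_of_ncard_neighborSet_eq_one h2 hdk
  have hσ := isEdgeFaithful_iso (swapPendants hj hk)
  have hι := isEdgeFaithful_deleteEmbedding hjk hj hk
  refine ⟨congrArg sSup ?_, congrArg sInf ?_, congrArg sSup ?_⟩
  · exact setOf_card_delete_pendant hjk hj hk (fun _ h => h) (isMatching_mapEdges _)
      (isMatching_mapEdges _)
  · exact setOf_card_delete_pendant hjk hj hk (fun _ h => h.1) hσ.isMaximalMatching_mapEdges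
      hι.isMaximalMatching_mapEdges
  · exact setOf_card_delete_pendant hjk hj hk (fun _ h => h.1) hσ.isInducedMatching_mapEdges
      hι.isInducedMatching_mapEdges

end EdgeIdealPaper
end
end
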